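/- Let l, u, l', u', a ∈ ℝⁿ and b ∈ ℝ with l_p ≤ l'_p and u'_p ≤ u_p for every coordinate p. Define ω = ∑_p (max(a_p, 0)·(u_p − l_p) + a_p l_p) − b and ω' = ∑_p (max(a_p, 0)·(u'_p − l'_p) + a_p l'_p) − b. Then ω' ≤ ω. (Monotonicity claim in the proof of Proposition 4: tightening the variables' bounds can only decrease the screening indicator ω, so the cost-cut screening removes at least as many constraints.) -/

import Mathlib

/-- Monotonicity of the screening indicator `ω`: tightening the variables' bounds can
only decrease `ω`. -/
theorem omega_monotone {n : ℕ} (l u l' u' a : Fin n → ℝ) (b : ℝ)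
    (hl : ∀ p, l p ≤ l' p) (hu : ∀ p, u' p ≤ u p) :
    (∑ p, (max (a p) 0 * (u' p - l' p) + a p * l' p) - b) ≤
      (∑ p, (max (a p) 0 * (u p - l p) + a p * l p) - b) := by
  gcongr ?_ - b
  refine Finset.sum_le_sum fun p _ => ?_
  have h₁ := mul_le_mul_of_nonneg_left (hu p) (le_max_right (a p) 0)
  have h₂ := mul_le_mul_of_nonneg_left (hl p) (sub_nonneg.2 (le_max_left (a p) 0))
  linarith
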